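/- Let G be a finite group and f₁, f₂ : G → ℂ class functions (functions constant on conjugacy classes). Then for every g ∈ G, ∑_{x ∈ G} f₁(x)·f₂(x⁻¹·g) = ∑_{χ ∈ Irr(G)} (|G|/χ(1)) · ⟨f₁, χ⟩ · ⟨f₂, χ⟩ · χ(g), where ⟨f, χ⟩ = (1/|G|) · ∑_{x ∈ G} f(x)·conj(χ(x)) and the sum runs over all irreducible complex characters of G. -/

import Mathlib

open CategoryTheory

lemma aux_schur {G : Type} [Group G] (V : FDRep ℂ G) [Simple V] (T : V →ₗ[ℂ] V)
    (h : ∀ g, T ∘ₗ V.ρ g = V.ρ g ∘ₗ T) : ∃ c : ℂ, T = c • LinearMap.id := by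
  let φ : V ⟶ V := ⟨InducedCategory.homMk (ModuleCat.ofHom T), fun g => by
    apply InducedCategory.hom_ext
    exact ModuleCat.hom_ext (h g)⟩
  obtain ⟨c, hc⟩ := endomorphism_simple_eq_smul_id ℂ φ
  refine ⟨c, ?_⟩
  have := congrArg (fun ψ : V ⟶ V => ψ.hom.hom.hom) hc
  exact this.symm

lemma aux_scalar {G : Type} [Group G] [Fintype G] (V : FDRep ℂ G) [Simple V] (f : G → ℂ)
    (hf : ∀ x y : G, f (y * x * y⁻¹) = f x) :
    ∃ c : ℂ, (∑ x, f x • V.ρ x) = c • LinearMap.id ∧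
      c * V.character 1 = ∑ x, f x * V.character x := by
  obtain ⟨c, hc⟩ := aux_schur V (∑ x, f x • V.ρ x) (by
    intro g
    change (∑ x, f x • V.ρ x) * V.ρ g = V.ρ g * (∑ x, f x • V.ρ x)
    rw [Finset.sum_mul, Finset.mul_sum]
    refine (Fintype.sum_equiv (MulAut.conj g).toEquiv _ _ fun x => ?_).symm
    simp only [MulEquiv.toEquiv_eq_coe, EquivLike.coe_coe, MulAut.conj_apply, hf, smul_mul_assoc,
      mul_smul_comm]
    rw [← map_mul, ← map_mul]; simp)
  refine ⟨c, hc, ?_⟩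
  have := congrArg (LinearMap.trace ℂ V) hc
  simp only [map_sum, map_smul, smul_eq_mul, LinearMap.trace_id] at this
  rw [FDRep.char_one]
  exact this.symm

lemma aux_pos {G : Type} [Group G] [Fintype G] (V : FDRep ℂ G) [Simple V] :
    V.character 1 ≠ 0 := by
  intro h
  rw [FDRep.char_one] at h
  have h0 : Module.finrank ℂ V = 0 := by exact_mod_cast h
  have : Subsingleton V := Module.finrank_zero_iff.1 h0
  apply id_nonzero V
  ext x
  exact Subsingleton.elim _ _

open scoped ComplexOrder in
lemma aux_conj {G : Type} [Group G] [Fintype G] (V : FDRep ℂ G) (g : G) :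
    starRingEnd ℂ (V.character g) = V.character g⁻¹ := by
  classical
  let b := Module.finBasis ℂ V
  let M : G → Matrix _ _ ℂ := fun x => LinearMap.toMatrix b b (V.ρ x)
  have hM : ∀ x y, M (x * y) = M x * M y := fun x y => by
    simp only [M, map_mul, LinearMap.toMatrix_mul]
  have hM1 : M 1 = 1 := by simp only [M, map_one, LinearMap.toMatrix_one]
  have htr : ∀ x, V.character x = (M x).trace := fun x => LinearMap.trace_eq_matrix_trace ℂ b _
  let P := ∑ x, (M x).conjTranspose * M x
  have hP : P.PosDef := by
    have : P = 1 + ∑ x ∈ Finset.univ.erase 1, (M x).conjTranspose * M x := by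
      simp only [P]
      rw [← Finset.add_sum_erase _ _ (Finset.mem_univ (1 : G)), hM1]; simp
    rw [this]
    exact Matrix.PosDef.one.add_posSemidef
      (Matrix.posSemidef_sum _ fun x _ => Matrix.posSemidef_conjTranspose_mul_self _)
  have hinv : (M g).conjTranspose * P * M g = P := by
    simp only [P, Finset.mul_sum, Finset.sum_mul]
    refine Fintype.sum_equiv (Equiv.mulRight g) _ _ fun x => ?_
    simp only [Equiv.coe_mulRight, hM, Matrix.conjTranspose_mul, Matrix.mul_assoc]
  have hgg : M g * M g⁻¹ = 1 := by rw [← hM, mul_inv_cancel, hM1]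
  have hd : IsUnit P.det := (Matrix.isUnit_iff_isUnit_det _).1 hP.isUnit
  have h2 : (M g).conjTranspose * P = P * M g⁻¹ := by
    calc _ = (M g).conjTranspose * P * (M g * M g⁻¹) := by rw [hgg, mul_one]
      _ = _ := by rw [← mul_assoc, hinv]
  have h3 : (M g).conjTranspose = P * M g⁻¹ * P⁻¹ := by
    rw [← h2, Matrix.mul_nonsing_inv_cancel_right _ _ hd]
  rw [htr, htr, starRingEnd_apply, ← Matrix.trace_conjTranspose, h3, Matrix.trace_mul_comm,
    Matrix.nonsing_inv_mul_cancel_left _ _ hd]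

lemma aux_mod {G : Type} [Group G] [Fintype G] (f : G → ℂ)
    (hf : ∀ x y : G, f (y * x * y⁻¹) = f x)
    (h : ∀ V : FDRep ℂ G, Simple V → ∑ x, f x * V.character x = 0)
    (Q : Type) [AddCommGroup Q] [Module (MonoidAlgebra ℂ G) Q]
    [Module ℂ Q] [IsScalarTower ℂ (MonoidAlgebra ℂ G) Q]
    [hQ : IsSimpleModule (MonoidAlgebra ℂ G) Q] (q : Q) :
    (∑ x, MonoidAlgebra.single x (f x) : MonoidAlgebra ℂ G) • q = 0 := by
  set a : MonoidAlgebra ℂ G := ∑ x, MonoidAlgebra.single x (f x) with ha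
  let ρ : Representation ℂ G Q := Representation.ofModule' (k := ℂ) (G := G) Q
  have hact : ∀ (r : MonoidAlgebra ℂ G) (v : Q), ρ.asAlgebraHom r v = r • v := by
    intro r v
    have : ρ.asAlgebraHom = Algebra.lsmul ℂ ℂ Q :=
      (MonoidAlgebra.lift ℂ (Q →ₗ[ℂ] Q) G).apply_symm_apply _
    rw [this]; rfl
  have hρ : ρ.IsIrreducible := by
    rw [Representation.irreducible_iff_isSimpleModule_asModule]
    let e : ρ.asModule ≃ₗ[MonoidAlgebra ℂ G] Q :=
      { ρ.asModuleEquiv.toAddEquiv with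
        map_smul' := fun r v => by
          change ρ.asModuleEquiv (r • v) = r • ρ.asModuleEquiv v
          rw [Representation.asModuleEquiv_map_smul, hact] }
    exact IsSimpleModule.congr e
  have hfin : Module.Finite ℂ Q := Module.Finite.trans (MonoidAlgebra ℂ G) _
  have := invertibleOfNonzero (NeZero.ne (Nat.card G : ℂ))
  have hs : Simple (FDRep.of ρ) := by
    rw [FDRep.simple_iff_char_is_norm_one]
    have := Representation.char_orthonormal ρ ρ
    rw [if_pos ⟨Representation.Equiv.refl ρ⟩] at this
    rw [inv_mul_eq_one₀ (NeZero.ne _)] at this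
    exact this.symm
  obtain ⟨c, hc, hc1⟩ := aux_scalar (FDRep.of ρ) f hf
  rw [h _ hs] at hc1
  have hc0 : c = 0 := (mul_eq_zero.1 hc1).resolve_right (aux_pos _)
  have hc' : ∑ x, f x • ρ x = c • LinearMap.id := hc
  have h1 : ρ.asAlgebraHom a = 0 := by
    simp only [a, map_sum, Representation.asAlgebraHom_single]
    rw [hc', hc0, zero_smul]
  rw [← hact, h1, LinearMap.zero_apply]

lemma aux_zero {G : Type} [Group G] [Fintype G] (f : G → ℂ)
    (hf : ∀ x y : G, f (y * x * y⁻¹) = f x)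
    (h : ∀ V : FDRep ℂ G, Simple V → ∑ x, f x * V.character x = 0) : f = 0 := by
  let a : MonoidAlgebra ℂ G := ∑ x, MonoidAlgebra.single x (f x)
  have ha : a = 0 := by
    have hj : a ∈ Ring.jacobson (MonoidAlgebra ℂ G) := by
      rw [← Ideal.jacobson_bot, Ideal.jacobson, Submodule.mem_sInf]
      rintro m ⟨-, hm⟩
      have hQ : IsSimpleModule (MonoidAlgebra ℂ G) (MonoidAlgebra ℂ G ⧸ m) :=
        isSimpleModule_iff_isCoatom.2 hm.out
      have h3 : a • (Submodule.Quotient.mk 1 : MonoidAlgebra ℂ G ⧸ m) = 0 := aux_mod f hf h _ _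
      rw [← Submodule.Quotient.mk_smul, Submodule.Quotient.mk_eq_zero] at h3
      simpa using h3
    rw [IsSemisimpleRing.jacobson_eq_bot] at hj
    simpa using hj
  funext y
  have := congrArg (fun b : MonoidAlgebra ℂ G => b.coeff y) ha
  classical
  simpa [a, Finsupp.finsetSum_apply, Finsupp.single_apply] using this

lemma aux_conv {G : Type} [Group G] [Fintype G] (V : FDRep ℂ G) [Simple V] (f₁ f₂ : G → ℂ)
    (hf₁ : ∀ x y : G, f₁ (y * x * y⁻¹) = f₁ x)
    (hf₂ : ∀ x y : G, f₂ (y * x * y⁻¹) = f₂ x) :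
    ∑ g, (∑ x, f₁ x * f₂ (x⁻¹ * g)) * V.character g⁻¹ =
      (∑ x, f₁ x * V.character x⁻¹) * (∑ x, f₂ x * V.character x⁻¹) / V.character 1 := by
  have key : ∀ f : G → ℂ, (∀ x y : G, f (y * x * y⁻¹) = f x) →
      ∃ c : ℂ, (∑ x, f x • V.ρ x⁻¹) = c • LinearMap.id ∧
      c * V.character 1 = ∑ x, f x * V.character x⁻¹ := by
    intro f hf
    obtain ⟨c, h1, h2⟩ := aux_scalar V (fun x => f x⁻¹) (by
      intro x y
      rw [← hf x⁻¹ y]; congr 1; group)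
    refine ⟨c, h1 ▸ ?_, h2.trans ?_⟩
    · exact Fintype.sum_equiv (Equiv.inv G) _ _ fun x => by simp
    · exact Fintype.sum_equiv (Equiv.inv G) _ _ fun x => by simp
  obtain ⟨c₁, h1, e1⟩ := key f₁ hf₁
  obtain ⟨c₂, h2, e2⟩ := key f₂ hf₂
  rw [← e1, ← e2, eq_div_iff (aux_pos V)]
  have h3 : (∑ y, f₂ y • V.ρ y⁻¹) * (∑ x, f₁ x • V.ρ x⁻¹) =
      (c₂ * c₁) • (LinearMap.id : V →ₗ[ℂ] V) := by
    rw [h1, h2]; ext v; simp [mul_smul, smul_comm c₁ c₂]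
  have h4 := congrArg (LinearMap.trace ℂ V) h3
  rw [map_smul, LinearMap.trace_id, Finset.mul_sum, map_sum] at h4
  simp only [Finset.sum_mul, map_sum, smul_mul_assoc, mul_smul_comm, map_smul, smul_eq_mul,
    ← map_mul] at h4
  have h5 : ∑ g, (∑ x, f₁ x * f₂ (x⁻¹ * g)) * V.character g⁻¹ = c₂ * c₁ * V.character 1 := by
    rw [FDRep.char_one, ← h4]
    simp only [Finset.sum_mul]
    rw [Finset.sum_comm]
    refine Finset.sum_congr rfl fun x _ => ?_
    rw [Finset.mul_sum]
    refine Fintype.sum_equiv (Equiv.mulLeft x⁻¹) _ _ fun y => ?_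
    have : (x⁻¹ * y)⁻¹ * x⁻¹ = y⁻¹ := by group
    simp only [Equiv.coe_mulLeft, this, FDRep.character]
    ring
  rw [h5]; ring


/-- Let `G` be a finite group and `f₁, f₂ : G → ℂ` class functions. Then
for every `g ∈ G`,
`∑_{x ∈ G} f₁(x)·f₂(x⁻¹·g) = ∑_χ (|G|/χ(1)) · ⟨f₁, χ⟩ · ⟨f₂, χ⟩ · χ(g)`,
where `⟨f, χ⟩ = (1/|G|) · ∑_x f(x)·conj(χ(x))` and the sum runs over a complete family of
irreducible complex characters of `G`. -/
theorem stmt6 {G : Type} [Group G] [Fintype G]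
    {ι : Type} [Fintype ι] (V : ι → FDRep ℂ G)
    (hsimple : ∀ i, Simple (V i))
    (hdistinct : ∀ i j, i ≠ j → IsEmpty (V i ≅ V j))
    (hcomplete : ∀ W : FDRep ℂ G, Simple W → ∃ i, Nonempty (W ≅ V i))
    (f₁ f₂ : G → ℂ)
    (hf₁ : ∀ x y : G, f₁ (y * x * y⁻¹) = f₁ x)
    (hf₂ : ∀ x y : G, f₂ (y * x * y⁻¹) = f₂ x)
    (g : G) :
    ∑ x : G, f₁ x * f₂ (x⁻¹ * g)
      = ∑ i, ((Fintype.card G : ℂ) / (V i).character 1)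
          * ((1 / (Fintype.card G : ℂ)) * ∑ x : G, f₁ x * starRingEnd ℂ ((V i).character x))
          * ((1 / (Fintype.card G : ℂ)) * ∑ x : G, f₂ x * starRingEnd ℂ ((V i).character x))
          * (V i).character g := by
  classical
  have hn : (Fintype.card G : ℂ) ≠ 0 := by exact_mod_cast Fintype.card_ne_zero
  simp only [aux_conj]
  set R : G → ℂ := fun g => ∑ i, ((Fintype.card G : ℂ) / (V i).character 1)
          * ((1 / (Fintype.card G : ℂ)) * ∑ x : G, f₁ x * (V i).character x⁻¹)
          * ((1 / (Fintype.card G : ℂ)) * ∑ x : G, f₂ x * (V i).character x⁻¹)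
          * (V i).character g with hR
  set F : G → ℂ := fun g => ∑ x : G, f₁ x * f₂ (x⁻¹ * g) with hF
  have hFc : ∀ x y, F (y * x * y⁻¹) = F x := by
    intro x y
    refine (Fintype.sum_equiv (MulAut.conj y).toEquiv _ _ fun z => ?_).symm
    simp only [MulEquiv.toEquiv_eq_coe, EquivLike.coe_coe, MulAut.conj_apply, hf₁]
    rw [← hf₂ (z⁻¹ * x) y]
    congr 2; group
  have hRc : ∀ x y, R (y * x * y⁻¹) = R x := by
    intro x y
    simp only [hR, FDRep.char_conj]
  have horth : ∀ i j, ∑ x, (V i).character x * (V j).character x⁻¹ =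
      if i = j then (Fintype.card G : ℂ) else 0 := by
    intro i j
    have := hsimple i
    have := hsimple j
    have := invertibleOfNonzero (NeZero.ne (Nat.card G : ℂ))
    have h := FDRep.char_orthonormal (V i) (V j)
    rw [Nat.card_eq_fintype_card, inv_mul_eq_iff_eq_mul₀ hn] at h
    rw [h]
    by_cases hij : i = j
    · subst hij
      rw [if_pos ⟨Iso.refl _⟩]; simp
    · rw [if_neg (not_nonempty_iff.2 (hdistinct i j hij))]; simp [hij]
  have hz : (fun x => F x⁻¹ - R x⁻¹) = 0 := by
    apply aux_zero
    · intro x y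
      have : (y * x * y⁻¹)⁻¹ = y * x⁻¹ * y⁻¹ := by group
      simp only [this, hFc, hRc]
    · intro W hW
      obtain ⟨j, ⟨e⟩⟩ := hcomplete W hW
      have := hsimple j
      rw [FDRep.char_iso e]
      have h1 : ∑ x, (F x⁻¹ - R x⁻¹) * (V j).character x =
          ∑ x, F x * (V j).character x⁻¹ - ∑ x, R x * (V j).character x⁻¹ := by
        rw [← Finset.sum_sub_distrib]
        exact Fintype.sum_equiv (Equiv.inv G) _ _ fun x => by simp [sub_mul]
      have h2 : ∑ x, R x * (V j).character x⁻¹ =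
          (∑ x, f₁ x * (V j).character x⁻¹) * (∑ x, f₂ x * (V j).character x⁻¹)
            / (V j).character 1 := by
        simp only [hR, Finset.sum_mul (s := (Finset.univ : Finset ι))]
        rw [Finset.sum_comm]
        simp only [mul_assoc _ (FDRep.character _ _) (FDRep.character _ _)]
        simp only [← Finset.mul_sum, horth]
        simp only [mul_ite, mul_zero, Finset.sum_ite_eq', Finset.mem_univ, if_true]
        have := aux_pos (V j)
        field_simp
      rw [h1, h2, aux_conv (V j) f₁ f₂ hf₁ hf₂, sub_self]
  have := congrFun hz g⁻¹
  simp only [inv_inv, Pi.zero_apply] at this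
  exact sub_eq_zero.1 this
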